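/- Let B := {ξ ∈ ℝ³ : |ξ| < 1} and let φ : (0,∞) × B → ℝ be twice continuously differentiable. Define v on Ω := {(t,x) ∈ ℝ × ℝ³ : |x| < t and t² − |x|² > t} by v(t,x) := √2/t + (1/t)·φ(−log(t/(t² − |x|²)), x/t). Then v satisfies the cubic focusing wave equation (−∂_t² + Δ_x)v + v³ = 0 on Ω if and only if φ satisfies, for all τ > 0 and ξ ∈ B, the equation ∂_τ²φ + 3∂_τφ + 2ξ^j ∂_{ξ^j}∂_τφ − (δ^{jk} − ξ^j ξ^k)∂_{ξ^j}∂_{ξ^k}φ + 4ξ^j ∂_{ξ^j}φ + 2φ = 6φ + 3√2·φ² + φ³. -/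

import Mathlib

noncomputable section

/-- Spacetime `ℝ × ℝ³` (also used for similarity coordinates `(τ,ξ)`). -/
abbrev Spc : Type := ℝ × EuclideanSpace ℝ (Fin 3)

/-- Directional derivative in the direction `w`. -/
noncomputable def dirDeriv (w : Spc) (v : Spc → ℝ) (p : Spc) : ℝ := fderiv ℝ v p w

/-- Time direction. -/
noncomputable def e0 : Spc := (1, 0)

/-- Spatial coordinate directions. -/
noncomputable def es (j : Fin 3) : Spc := (0, EuclideanSpace.single j 1)

/-- Second time derivative. -/
noncomputable def dtt (v : Spc → ℝ) : Spc → ℝ := dirDeriv e0 (dirDeriv e0 v)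

/-- Spatial Laplacian. -/
noncomputable def lap (v : Spc → ℝ) (p : Spc) : ℝ :=
  ∑ j : Fin 3, dirDeriv (es j) (dirDeriv (es j) v) p

/-- `f` is differentiable at `p` and its derivative in the direction `w` is `d`. -/
def HasDirDeriv (w : Spc) (f : Spc → ℝ) (d : ℝ) (p : Spc) : Prop :=
  ∃ f' : Spc →L[ℝ] ℝ, HasFDerivAt f f' p ∧ f' w = d

namespace HasDirDeriv

variable {w p : Spc} {f g : Spc → ℝ} {a b : ℝ}

theorem dirDeriv_eq (h : HasDirDeriv w f a p) : dirDeriv w f p = a := by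
  obtain ⟨f', hf, rfl⟩ := h
  rw [dirDeriv, hf.fderiv]

theorem congr_val (h : HasDirDeriv w f a p) (hab : a = b) : HasDirDeriv w f b p := hab ▸ h

theorem const (c : ℝ) : HasDirDeriv w (fun _ => c) 0 p :=
  ⟨0, hasFDerivAt_const c p, rfl⟩

theorem add (hf : HasDirDeriv w f a p) (hg : HasDirDeriv w g b p) :
    HasDirDeriv w (fun q => f q + g q) (a + b) p := by
  obtain ⟨f', hf, rfl⟩ := hf
  obtain ⟨g', hg, rfl⟩ := hg
  exact ⟨_, hf.add hg, rfl⟩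

theorem sub (hf : HasDirDeriv w f a p) (hg : HasDirDeriv w g b p) :
    HasDirDeriv w (fun q => f q - g q) (a - b) p := by
  obtain ⟨f', hf, rfl⟩ := hf
  obtain ⟨g', hg, rfl⟩ := hg
  exact ⟨_, hf.sub hg, rfl⟩

theorem mul (hf : HasDirDeriv w f a p) (hg : HasDirDeriv w g b p) :
    HasDirDeriv w (fun q => f q * g q) (f p * b + g p * a) p := by
  obtain ⟨f', hf, rfl⟩ := hf
  obtain ⟨g', hg, rfl⟩ := hg
  exact ⟨_, hf.mul hg, by simp⟩

theorem sum {F : Fin 3 → Spc → ℝ} {A : Fin 3 → ℝ} (h : ∀ k, HasDirDeriv w (F k) (A k) p) :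
    HasDirDeriv w (fun q => ∑ k, F k q) (∑ k, A k) p := by
  choose F' hF hA using h
  exact ⟨∑ k, F' k, HasFDerivAt.fun_sum fun k _ => hF k, by simp [hA]⟩

theorem comp_hasDerivAt {u : ℝ → ℝ} {u' : ℝ} (hf : HasDirDeriv w f a p)
    (hu : HasDerivAt u u' (f p)) : HasDirDeriv w (fun q => u (f q)) (u' * a) p := by
  obtain ⟨f', hf, rfl⟩ := hf
  exact ⟨_, hu.comp_hasFDerivAt p hf, by simp⟩

theorem inv (hf : HasDirDeriv w f a p) (h0 : f p ≠ 0) :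
    HasDirDeriv w (fun q => (f q)⁻¹) (-(a * (f p)⁻¹ ^ 2)) p :=
  (hf.comp_hasDerivAt (hasDerivAt_inv h0)).congr_val (by rw [inv_pow]; ring)

theorem fst : HasDirDeriv w (fun q => q.1) w.1 p :=
  ⟨_, hasFDerivAt_fst, rfl⟩

theorem coord (k : Fin 3) : HasDirDeriv w (fun q => q.2 k) (w.2 k) p :=
  ⟨_, ((EuclideanSpace.proj k).comp
    (ContinuousLinearMap.snd ℝ ℝ (EuclideanSpace ℝ (Fin 3)))).hasFDerivAt, rfl⟩

theorem congr_of_eventuallyEq (h : HasDirDeriv w f a p) (hfg : g =ᶠ[nhds p] f) :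
    HasDirDeriv w g a p := by
  obtain ⟨f', hf, rfl⟩ := h
  exact ⟨f', hf.congr_of_eventuallyEq hfg, rfl⟩

end HasDirDeriv

/-- The region `|x| < t`, `t² - |x|² > t`. -/
def physRegion : Set Spc := {p | ‖p.2‖ < p.1 ∧ p.1 < p.1 ^ 2 - ‖p.2‖ ^ 2}

/-- The cylinder `τ > 0`, `|ξ| < 1`. -/
def simCylinder : Set Spc := {q | 0 < q.1 ∧ ‖q.2‖ < 1}

/-- The similarity coordinates `(τ, ξ)` of the point `(t, x)`. -/
def simCoord (p : Spc) : Spc :=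
  (-Real.log (p.1 / (p.1 ^ 2 - ‖p.2‖ ^ 2)), p.1⁻¹ • p.2)

/-- The Lorentzian square `t² - |x|²`. -/
def lorentzSq (p : Spc) : ℝ := p.1 ^ 2 - ‖p.2‖ ^ 2

theorem isOpen_physRegion : IsOpen physRegion := by
  have h1 : Continuous fun p : Spc => ‖p.2‖ := by fun_prop
  have h2 : Continuous fun p : Spc => p.1 ^ 2 - ‖p.2‖ ^ 2 := by fun_prop
  exact (isOpen_lt h1 continuous_fst).inter (isOpen_lt continuous_fst h2)

theorem isOpen_simCylinder : IsOpen simCylinder := by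
  have h1 : Continuous fun p : Spc => ‖p.2‖ := by fun_prop
  exact (isOpen_lt continuous_const continuous_fst).inter (isOpen_lt h1 continuous_const)

theorem fst_pos_of_mem_physRegion {p : Spc} (hp : p ∈ physRegion) : 0 < p.1 :=
  (norm_nonneg _).trans_lt hp.1

theorem lorentzSq_pos {p : Spc} (hp : p ∈ physRegion) : 0 < lorentzSq p :=
  (fst_pos_of_mem_physRegion hp).trans hp.2

theorem lorentzSq_eq (p : Spc) : lorentzSq p = p.1 ^ 2 - ∑ k, p.2 k ^ 2 := by
  rw [lorentzSq, EuclideanSpace.real_norm_sq_eq]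

theorem simCoord_mem {p : Spc} (hp : p ∈ physRegion) : simCoord p ∈ simCylinder := by
  have ht := fst_pos_of_mem_physRegion hp
  have hs : 0 < p.1 ^ 2 - ‖p.2‖ ^ 2 := lorentzSq_pos hp
  refine ⟨?_, ?_⟩
  · exact neg_pos.2 (Real.log_neg (div_pos ht hs) ((div_lt_one hs).2 hp.2))
  · simp only [simCoord, norm_smul, norm_inv, Real.norm_eq_abs, abs_of_pos ht]
    rw [inv_mul_lt_iff₀ ht]
    simpa using hp.1

theorem exists_simCoord_eq {q : Spc} (hq : q ∈ simCylinder) :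
    ∃ p ∈ physRegion, simCoord p = q := by
  obtain ⟨h0, h1⟩ := hq
  have hr : 0 < 1 - ‖q.2‖ ^ 2 := by nlinarith [norm_nonneg q.2]
  set t := Real.exp q.1 / (1 - ‖q.2‖ ^ 2) with ht
  have htpos : 0 < t := div_pos (Real.exp_pos _) hr
  have hts : t * (1 - ‖q.2‖ ^ 2) = Real.exp q.1 := div_mul_cancel₀ _ hr.ne'
  have hn : ‖t • q.2‖ = t * ‖q.2‖ := by rw [norm_smul, Real.norm_of_nonneg htpos.le]
  have hs : t ^ 2 - ‖t • q.2‖ ^ 2 = t * Real.exp q.1 := by rw [hn, ← hts]; ring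
  refine ⟨(t, t • q.2), ⟨?_, ?_⟩, Prod.ext ?_ ?_⟩
  · simp only [hn]
    nlinarith
  · simp only [hs]
    nlinarith [Real.add_one_lt_exp h0.ne']
  · simp only [simCoord, hs]
    rw [← div_div, div_self htpos.ne', one_div, Real.log_inv, Real.log_exp, neg_neg]
  · simp [simCoord, smul_smul, inv_mul_cancel₀ htpos.ne']

theorem hasDirDeriv_lorentzSq (w p : Spc) :
    HasDirDeriv w lorentzSq (2 * p.1 * w.1 - ∑ k, 2 * p.2 k * w.2 k) p := by
  have h := (HasDirDeriv.fst (w := w) (p := p)).mul HasDirDeriv.fst |>.sub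
    (HasDirDeriv.sum fun k => (HasDirDeriv.coord (w := w) (p := p) k).mul (HasDirDeriv.coord k))
  refine (h.congr_of_eventuallyEq (.of_forall fun q => ?_)).congr_val ?_
  · simp only [lorentzSq_eq, pow_two]
  · congr 1
    · ring
    · exact Finset.sum_congr rfl fun k _ => by ring

theorem hasDirDeriv_simCoord_fst {p : Spc} (hp : p ∈ physRegion) (w : Spc) :
    HasDirDeriv w (fun p => (simCoord p).1)
      ((lorentzSq p)⁻¹ * (2 * p.1 * w.1 - ∑ k, 2 * p.2 k * w.2 k) - p.1⁻¹ * w.1) p := by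
  have ht := fst_pos_of_mem_physRegion hp
  have h := ((hasDirDeriv_lorentzSq w p).comp_hasDerivAt
    (Real.hasDerivAt_log (lorentzSq_pos hp).ne')).sub
    ((HasDirDeriv.fst (w := w) (p := p)).comp_hasDerivAt (Real.hasDerivAt_log ht.ne'))
  refine h.congr_of_eventuallyEq ?_
  filter_upwards [isOpen_physRegion.mem_nhds hp] with q hq
  have hs : q.1 ^ 2 - ‖q.2‖ ^ 2 ≠ 0 := (lorentzSq_pos hq).ne'
  simp only [simCoord, lorentzSq]
  rw [Real.log_div (fst_pos_of_mem_physRegion hq).ne' hs, neg_sub]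

theorem hasDirDeriv_simCoord_snd {p : Spc} (hp : p ∈ physRegion) (w : Spc) (k : Fin 3) :
    HasDirDeriv w (fun p => (simCoord p).2 k)
      (p.1⁻¹ * w.2 k - p.2 k * (w.1 * p.1⁻¹ ^ 2)) p :=
  (((HasDirDeriv.fst (w := w)).inv (fst_pos_of_mem_physRegion hp).ne').mul
    (HasDirDeriv.coord k)).congr_val (by ring)

theorem eq_smul_e0_add_sum (z : Spc) : z = z.1 • e0 + ∑ k, z.2 k • es k := by
  refine Prod.ext ?_ ?_
  · simp [e0, es, Prod.fst_sum]
  · ext i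
    fin_cases i <;> simp [e0, es, Fin.sum_univ_three]

/-- Chain rule in coordinates. -/
theorem HasDirDeriv.comp_coord {ψ : Spc → ℝ} {G : Spc → Spc} {w p : Spc} {a : ℝ} {b : Fin 3 → ℝ}
    (hψ : DifferentiableAt ℝ ψ (G p)) (h1 : HasDirDeriv w (fun q => (G q).1) a p)
    (h2 : ∀ k, HasDirDeriv w (fun q => (G q).2 k) (b k) p) :
    HasDirDeriv w (fun q => ψ (G q))
      (a * dirDeriv e0 ψ (G p) + ∑ k, b k * dirDeriv (es k) ψ (G p)) p := by
  obtain ⟨a', ha, rfl⟩ := h1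
  choose b' hb hb' using h2
  have hG2 := (PiLp.hasFDerivAt_toLp 2 (fun k => (G p).2 k)).comp p (hasFDerivAt_pi.2 hb)
  refine ⟨_, hψ.hasFDerivAt.comp p (ha.prodMk hG2), ?_⟩
  rw [ContinuousLinearMap.comp_apply, eq_smul_e0_add_sum ((a'.prod _) w)]
  simp [dirDeriv, ← hb']

theorem differentiableAt_dirDeriv {φ : Spc → ℝ} {q : Spc} (w : Spc) (h : ContDiffAt ℝ 2 φ q) :
    DifferentiableAt ℝ (dirDeriv w φ) q :=
  ((h.fderiv_right (m := 1) (by norm_num)).differentiableAt (by norm_num)).clm_apply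
    (differentiableAt_const w)

theorem dirDeriv_comm {φ : Spc → ℝ} {q : Spc} (w z : Spc) (h : ContDiffAt ℝ 2 φ q) :
    dirDeriv w (dirDeriv z φ) q = dirDeriv z (dirDeriv w φ) q := by
  have hd := (h.fderiv_right (m := 1) (by norm_num)).differentiableAt (by norm_num)
  have key : ∀ w z : Spc, dirDeriv w (dirDeriv z φ) q = fderiv ℝ (fderiv ℝ φ) q w z := by
    intro w z
    have := hd.hasFDerivAt.clm_apply (hasFDerivAt_const z q)
    rw [dirDeriv, show dirDeriv z φ = fun y => fderiv ℝ φ y z from rfl, this.fderiv]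
    simp
  rw [key, key]
  exact (h.isSymmSndFDerivAt (by simp)) w z

/-- Time derivative of a function of the similarity coordinates. -/
theorem hasDirDeriv_e0_comp_simCoord {ψ : Spc → ℝ} {p : Spc} (hp : p ∈ physRegion)
    (hψ : DifferentiableAt ℝ ψ (simCoord p)) :
    HasDirDeriv e0 (fun q => ψ (simCoord q))
      ((2 * p.1 * (lorentzSq p)⁻¹ - p.1⁻¹) * dirDeriv e0 ψ (simCoord p) -
        p.1⁻¹ * p.1⁻¹ * ∑ k, p.2 k * dirDeriv (es k) ψ (simCoord p)) p := by
  refine (HasDirDeriv.comp_coord hψ (hasDirDeriv_simCoord_fst hp e0)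
    (hasDirDeriv_simCoord_snd hp e0)).congr_val ?_
  simp [e0, Fin.sum_univ_three]
  ring

/-- Spatial derivatives of a function of the similarity coordinates. -/
theorem hasDirDeriv_es_comp_simCoord {ψ : Spc → ℝ} {p : Spc} (hp : p ∈ physRegion)
    (hψ : DifferentiableAt ℝ ψ (simCoord p)) (j : Fin 3) :
    HasDirDeriv (es j) (fun q => ψ (simCoord q))
      (p.1⁻¹ * dirDeriv (es j) ψ (simCoord p) -
        2 * p.2 j * (lorentzSq p)⁻¹ * dirDeriv e0 ψ (simCoord p)) p := by
  refine (HasDirDeriv.comp_coord hψ (hasDirDeriv_simCoord_fst hp (es j))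
    (hasDirDeriv_simCoord_snd hp (es j))).congr_val ?_
  fin_cases j <;> simp [es] <;> ring

/-- The ansatz `v(t, x) = (√2 + φ(τ, ξ)) / t`. -/
def simAnsatz (φ : Spc → ℝ) (p : Spc) : ℝ := p.1⁻¹ * (Real.sqrt 2 + φ (simCoord p))

theorem hasDirDeriv_e0_simAnsatz {φ : Spc → ℝ} {p : Spc} (hp : p ∈ physRegion)
    (hφ : DifferentiableAt ℝ φ (simCoord p)) :
    HasDirDeriv e0 (simAnsatz φ)
      (p.1⁻¹ * ((2 * p.1 * (lorentzSq p)⁻¹ - p.1⁻¹) * dirDeriv e0 φ (simCoord p) -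
        p.1⁻¹ * p.1⁻¹ * ∑ k, p.2 k * dirDeriv (es k) φ (simCoord p)) -
        p.1⁻¹ * p.1⁻¹ * (Real.sqrt 2 + φ (simCoord p))) p := by
  refine ((HasDirDeriv.fst.inv (fst_pos_of_mem_physRegion hp).ne').mul
    ((HasDirDeriv.const _).add (hasDirDeriv_e0_comp_simCoord hp hφ))).congr_val ?_
  simp [e0]
  ring

theorem hasDirDeriv_es_simAnsatz {φ : Spc → ℝ} {p : Spc} (hp : p ∈ physRegion)
    (hφ : DifferentiableAt ℝ φ (simCoord p)) (j : Fin 3) :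
    HasDirDeriv (es j) (simAnsatz φ)
      (p.1⁻¹ * (p.1⁻¹ * dirDeriv (es j) φ (simCoord p) -
        2 * p.2 j * (lorentzSq p)⁻¹ * dirDeriv e0 φ (simCoord p))) p := by
  refine ((HasDirDeriv.fst.inv (fst_pos_of_mem_physRegion hp).ne').mul
    ((HasDirDeriv.const _).add (hasDirDeriv_es_comp_simCoord hp hφ j))).congr_val ?_
  simp [es]

/-- The residual (left minus right side) of the equation in similarity coordinates. -/
def simResidual (φ : Spc → ℝ) (q : Spc) : ℝ :=
  (dtt φ q + 3 * dirDeriv e0 φ q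
    + 2 * (∑ j : Fin 3, q.2 j * dirDeriv (es j) (dirDeriv e0 φ) q)
    - (∑ j : Fin 3, ∑ k : Fin 3,
        ((if j = k then (1:ℝ) else 0) - q.2 j * q.2 k) *
          dirDeriv (es j) (dirDeriv (es k) φ) q)
    + 4 * (∑ j : Fin 3, q.2 j * dirDeriv (es j) φ q)
    + 2 * φ q) - (6 * φ q + 3 * Real.sqrt 2 * (φ q) ^ 2 + (φ q) ^ 3)


/-- The ansatz turns the wave equation into the equation in similarity coordinates. -/
theorem wave_simAnsatz {φ : Spc → ℝ} (hφ : ContDiffOn ℝ 2 φ simCylinder) {p : Spc}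
    (hp : p ∈ physRegion) :
    -dtt (simAnsatz φ) p + lap (simAnsatz φ) p + simAnsatz φ p ^ 3 =
      -(p.1⁻¹ ^ 3 * simResidual φ (simCoord p)) := by
  have hC : ∀ q ∈ physRegion, ContDiffAt ℝ 2 φ (simCoord q) := fun q hq =>
    hφ.contDiffAt (isOpen_simCylinder.mem_nhds (simCoord_mem hq))
  have hd : ∀ q ∈ physRegion, DifferentiableAt ℝ φ (simCoord q) := fun q hq =>
    (hC q hq).differentiableAt (by norm_num)
  have hdd : ∀ w, DifferentiableAt ℝ (dirDeriv w φ) (simCoord p) := fun w =>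
    differentiableAt_dirDeriv w (hC p hp)
  have ht := (fst_pos_of_mem_physRegion hp).ne'
  have hs := (lorentzSq_pos hp).ne'
  have hI : ∀ w, HasDirDeriv w (fun q => q.1⁻¹) _ p := fun w => HasDirDeriv.fst.inv ht
  have hS : ∀ w, HasDirDeriv w (fun q => (lorentzSq q)⁻¹) _ p := fun w =>
    (hasDirDeriv_lorentzSq w p).inv hs
  have h00 : HasDirDeriv e0 (dirDeriv e0 (simAnsatz φ)) _ p :=
    (((hI e0).mul ((((((HasDirDeriv.const 2).mul HasDirDeriv.fst).mul (hS e0)).sub (hI e0)).mul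
      (hasDirDeriv_e0_comp_simCoord hp (hdd e0))).sub (((hI e0).mul (hI e0)).mul
      (HasDirDeriv.sum fun k => (HasDirDeriv.coord k).mul
        (hasDirDeriv_e0_comp_simCoord hp (hdd (es k))))))).sub
      (((hI e0).mul (hI e0)).mul ((HasDirDeriv.const (Real.sqrt 2)).add
        (hasDirDeriv_e0_comp_simCoord hp (hd p hp))))).congr_of_eventuallyEq <| by
    filter_upwards [isOpen_physRegion.mem_nhds hp] with q hq
    exact (hasDirDeriv_e0_simAnsatz hq (hd q hq)).dirDeriv_eq
  have hjj : ∀ j, HasDirDeriv (es j) (dirDeriv (es j) (simAnsatz φ)) _ p := fun j =>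
    ((hI (es j)).mul (((hI (es j)).mul (hasDirDeriv_es_comp_simCoord hp (hdd (es j)) j)).sub
      ((((HasDirDeriv.const 2).mul (HasDirDeriv.coord j)).mul (hS (es j))).mul
        (hasDirDeriv_es_comp_simCoord hp (hdd e0) j)))).congr_of_eventuallyEq <| by
    filter_upwards [isOpen_physRegion.mem_nhds hp] with q hq
    exact (hasDirDeriv_es_simAnsatz hq (hd q hq) j).dirDeriv_eq
  have hcomm : ∀ k, dirDeriv e0 (dirDeriv (es k) φ) (simCoord p) =
      dirDeriv (es k) (dirDeriv e0 φ) (simCoord p) := fun k => dirDeriv_comm _ _ (hC p hp)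
  have hx : ∀ k, (simCoord p).2 k = p.1⁻¹ * p.2 k := fun k => rfl
  have hsq : Real.sqrt 2 ^ 2 = 2 := Real.sq_sqrt (by norm_num)
  have hsum := lorentzSq_eq p
  simp only [dtt, lap, h00.dirDeriv_eq, (hjj _).dirDeriv_eq, simResidual, simAnsatz, hcomm, hx,
    Fin.sum_univ_three] at hsum ⊢
  have hcube : (p.1⁻¹ * (Real.sqrt 2 + φ (simCoord p))) ^ 3 = p.1⁻¹ ^ 3 *
      (2 * Real.sqrt 2 + 6 * φ (simCoord p) + 3 * Real.sqrt 2 * φ (simCoord p) ^ 2 +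
        φ (simCoord p) ^ 3) := by
    linear_combination p.1⁻¹ ^ 3 * (Real.sqrt 2 + 3 * φ (simCoord p)) * hsq
  rw [hcube]
  rw [hsum] at hs ⊢
  generalize simCoord p = q
  simp [e0, es]
  field_simp
  ring

/-- In similarity coordinates `τ = -log(t/(t²-|x|²))`, `ξ = x/t`,
`v(t,x) = √2/t + (1/t)·φ(τ,ξ)` solves the cubic wave equation
`(-∂_t² + Δ)v + v³ = 0` on `Ω = {|x| < t, t² - |x|² > t}` if and only if `φ` solves
`∂_τ²φ + 3∂_τφ + 2ξ^j∂_j∂_τφ - (δ^{jk}-ξ^jξ^k)∂_j∂_kφ + 4ξ^j∂_jφ + 2φ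
  = 6φ + 3√2 φ² + φ³` on `(0,∞) × B`. -/
theorem stmt4 (φ : Spc → ℝ)
    (hφ : ContDiffOn ℝ 2 φ {q : Spc | 0 < q.1 ∧ ‖q.2‖ < 1})
    (v : Spc → ℝ)
    (hv : v = fun p : Spc => Real.sqrt 2 / p.1 +
      (1 / p.1) * φ (-Real.log (p.1 / (p.1 ^ 2 - ‖p.2‖ ^ 2)), p.1⁻¹ • p.2)) :
    (∀ p ∈ {p : Spc | ‖p.2‖ < p.1 ∧ p.1 < p.1 ^ 2 - ‖p.2‖ ^ 2},
        -dtt v p + lap v p + (v p) ^ 3 = 0) ↔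
    (∀ q ∈ {q : Spc | 0 < q.1 ∧ ‖q.2‖ < 1},
        dtt φ q + 3 * dirDeriv e0 φ q
          + 2 * (∑ j : Fin 3, q.2 j * dirDeriv (es j) (dirDeriv e0 φ) q)
          - (∑ j : Fin 3, ∑ k : Fin 3,
              ((if j = k then (1:ℝ) else 0) - q.2 j * q.2 k) *
                dirDeriv (es j) (dirDeriv (es k) φ) q)
          + 4 * (∑ j : Fin 3, q.2 j * dirDeriv (es j) φ q)
          + 2 * φ q
        = 6 * φ q + 3 * Real.sqrt 2 * (φ q) ^ 2 + (φ q) ^ 3) := by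
  have hv' : v = simAnsatz φ := by
    rw [hv]
    funext p
    simp only [simAnsatz, simCoord]
    ring
  change (∀ p ∈ physRegion, _) ↔ ∀ q ∈ simCylinder, _
  subst hv'
  constructor
  · intro h q hq
    obtain ⟨p, hp, rfl⟩ := exists_simCoord_eq hq
    have hw := h p hp
    rw [wave_simAnsatz hφ hp, neg_eq_zero, mul_eq_zero] at hw
    exact sub_eq_zero.1
      (hw.resolve_left (pow_ne_zero 3 (inv_ne_zero (fst_pos_of_mem_physRegion hp).ne')))
  · intro h p hp
    rw [wave_simAnsatz hφ hp, show simResidual φ (simCoord p) = 0 from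
      sub_eq_zero.2 (h _ (simCoord_mem hp)), mul_zero, neg_zero]
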